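/- Let p ∈ ℂ[x] be nonzero, σ an anti-involution of 𝒟ᵃ_p preserving the principal ℤ-gradation, σ₀ : 𝒟ᵃ → 𝒟ᵃ the unique map with σ(X·p(D)) = σ₀(X)·p(D), and for each k ∈ ℤ let ε_k ∈ {1, −1} be the unique scalar with σ₀(t^k) = ε_k·t^k. Then ε_{k+m} = ε₀·ε_k·ε_m for all k, m ∈ ℤ, and consequently ε_k = ε₀·(ε₀ε₁)^k for all k ∈ ℤ. -/

import Mathlib

noncomputable section

/-- ℂ[t,t⁻¹] as a ℂ-vector space with basis {t^j}_{j∈ℤ}; t^j is `Finsupp.single j 1`. -/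
abbrev LaurentV : Type := ℤ →₀ ℂ

/-- The regular differential operator `t^k f(D)` (where D = t·d/dt), acting by
t^j ↦ f(j)·t^{j+k}. -/
def op (k : ℤ) (f : Polynomial ℂ) : Module.End ℂ LaurentV :=
  Finsupp.lsum ℂ fun j => f.eval (j : ℂ) • Finsupp.lsingle (j + k)

/-- The graded piece (𝒟ᵃ_p)_j = {t^j f(D) p(D) : f ∈ ℂ[x]}. -/
def Dgrade (p : Polynomial ℂ) (j : ℤ) : Submodule ℂ (Module.End ℂ LaurentV) :=
  Submodule.span ℂ {A | ∃ f : Polynomial ℂ, A = op j (f * p)}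

/-- 𝒟ᵃ_p = 𝒟ᵃ·p(D). -/
def Dp (p : Polynomial ℂ) : Submodule ℂ (Module.End ℂ LaurentV) :=
  Submodule.span ℂ {A | ∃ (k : ℤ) (f : Polynomial ℂ), A = op k (f * p)}

/-- σ is an anti-involution: it is ℂ-linear (built into the type), involutive, and
reverses products. -/
def IsAntiInvolutionOn (p : Polynomial ℂ) (σ : ↥(Dp p) →ₗ[ℂ] ↥(Dp p)) : Prop :=
  (∀ A : ↥(Dp p), σ (σ A) = A) ∧
  (∀ A B W : ↥(Dp p),
    (W : Module.End ℂ LaurentV) = (A : Module.End ℂ LaurentV) * (B : Module.End ℂ LaurentV) →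
    ((σ W : Module.End ℂ LaurentV)) = (σ B : Module.End ℂ LaurentV) * (σ A : Module.End ℂ LaurentV))

/-- σ preserves the principal ℤ-gradation. -/
def PreservesGrading (p : Polynomial ℂ) (σ : ↥(Dp p) →ₗ[ℂ] ↥(Dp p)) : Prop :=
  ∀ (j : ℤ) (A : ↥(Dp p)), (A : Module.End ℂ LaurentV) ∈ Dgrade p j →
    ((σ A : Module.End ℂ LaurentV)) ∈ Dgrade p j

/-- σ(t^k f(D) p(D)) = (-1)^{deg p}·e^k·t^k f(−D−k+c)p(D). -/
def SigmaFormula (p : Polynomial ℂ) (c e : ℂ) (σ : ↥(Dp p) →ₗ[ℂ] ↥(Dp p)) : Prop :=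
  ∀ (k : ℤ) (f : Polynomial ℂ) (A : ↥(Dp p)), (A : Module.End ℂ LaurentV) = op k (f * p) →
    ((σ A : Module.End ℂ LaurentV)) =
      ((-1 : ℂ) ^ p.natDegree * e ^ k) •
        op k ((f.comp (Polynomial.C (c - (k : ℂ)) - Polynomial.X)) * p)

/-- The graded piece (𝒟_p^±)_k = {d ∈ (𝒟_p)_k : σ_±(d) = −d}, as a set. -/
def DpmGradeSet (p : Polynomial ℂ) (c e : ℂ) (k : ℤ) : Set (Module.End ℂ LaurentV) :=
  {A | ∃ f : Polynomial ℂ, A = op k (f * p) ∧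
    ((-1 : ℂ) ^ p.natDegree * e ^ k) •
      op k ((f.comp (Polynomial.C (c - (k : ℂ)) - Polynomial.X)) * p) = -A}

/-- The graded piece (𝒟_p^±)_k, as a ℂ-subspace. -/
def DpmGrade (p : Polynomial ℂ) (c e : ℂ) (k : ℤ) : Submodule ℂ (Module.End ℂ LaurentV) :=
  Submodule.span ℂ (DpmGradeSet p c e k)

/-- V has finite codimension in W. -/
def FinCodimIn {M : Type*} [AddCommGroup M] [Module ℂ M] (V W : Submodule ℂ M) : Prop :=
  FiniteDimensional ℂ (↥W ⧸ Submodule.comap W.subtype V)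

theorem op_apply_single (k : ℤ) (f : Polynomial ℂ) (j : ℤ) (a : ℂ) :
    op k f (Finsupp.single j a) = Finsupp.single (j + k) (f.eval (j : ℂ) * a) := by
  simp [op]

theorem op_mul_op (k m : ℤ) (f g : Polynomial ℂ) :
    op k f * op m g = op (k + m) (Polynomial.taylor (m : ℂ) f * g) := by
  refine Finsupp.lhom_ext fun j a => ?_
  rw [Module.End.mul_apply, op_apply_single, op_apply_single, op_apply_single,
    Polynomial.eval_mul, Polynomial.taylor_eval, mul_assoc, add_assoc, add_comm m k]
  push_cast
  rfl

theorem op_add (k : ℤ) (f g : Polynomial ℂ) : op k (f + g) = op k f + op k g := by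
  refine Finsupp.lhom_ext fun j a => ?_
  rw [LinearMap.add_apply, op_apply_single, op_apply_single, op_apply_single,
    Polynomial.eval_add, add_mul, Finsupp.single_add]

theorem op_smul (k : ℤ) (c : ℂ) (f : Polynomial ℂ) : op k (c • f) = c • op k f := by
  refine Finsupp.lhom_ext fun j a => ?_
  rw [LinearMap.smul_apply, op_apply_single, op_apply_single, Polynomial.eval_smul,
    Finsupp.smul_single, smul_eq_mul, smul_eq_mul, mul_assoc]

/-- `op k` as a linear map in the polynomial. -/
def opLinear (k : ℤ) : Polynomial ℂ →ₗ[ℂ] Module.End ℂ LaurentV where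
  toFun := op k
  map_add' := op_add k
  map_smul' := op_smul k

theorem op_injective (k : ℤ) : Function.Injective (op k) := by
  intro f g h
  refine Polynomial.eq_of_infinite_eval_eq f g <|
    (Set.infinite_range_of_injective (Int.cast_injective (α := ℂ))).mono ?_
  rintro _ ⟨j, rfl⟩
  have hj := congrArg (fun A : Module.End ℂ LaurentV => A (Finsupp.single j 1)) h
  simp only [op_apply_single, mul_one] at hj
  exact Finsupp.single_injective _ hj

theorem op_mem_Dp (p : Polynomial ℂ) (k : ℤ) (f : Polynomial ℂ) : op k (f * p) ∈ Dp p :=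
  Submodule.subset_span ⟨k, f, rfl⟩

/-- The linear map `f ↦ t^k f(D) p(D)` into `𝒟ᵃ_p`. -/
def opDp (p : Polynomial ℂ) (k : ℤ) : Polynomial ℂ →ₗ[ℂ] ↥(Dp p) :=
  ((opLinear k).comp (LinearMap.mulRight ℂ p)).codRestrict (Dp p) (op_mem_Dp p k)

theorem coe_opDp (p : Polynomial ℂ) (k : ℤ) (f : Polynomial ℂ) :
    (opDp p k f : Module.End ℂ LaurentV) = op k (f * p) :=
  rfl

/-- A relation `∑ cᵢ p(x + yᵢ) = 0` kills every polynomial of degree at most `deg p`. -/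
theorem sum_mul_eval_eq_zero_of_sum_taylor_eq_zero {ι : Type*} (s : Finset ι) (c y : ι → ℂ)
    {p : Polynomial ℂ} (hp : p ≠ 0) (h : ∑ i ∈ s, c i • Polynomial.taylor (y i) p = 0)
    (n : ℕ) (q : Polynomial ℂ) (hn : n ≤ p.natDegree) (hq : q.degree ≤ n) :
    ∑ i ∈ s, c i * q.eval (y i) = 0 := by
  induction n using Nat.strong_induction_on generalizing q with
  | _ n ih =>
    set r := Polynomial.hasseDeriv (p.natDegree - n) p with hr
    have hrsum : ∑ i ∈ s, c i * r.eval (y i) = 0 := by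
      simpa [Polynomial.taylor_coeff, Polynomial.finsetSum_coeff] using
        congrArg (fun f => Polynomial.coeff f (p.natDegree - n)) h
    have hrdeg : r.natDegree = n := by
      rw [hr, Polynomial.natDegree_hasseDeriv]; omega
    have hrcoeff : r.coeff n ≠ 0 := by
      rw [hr, Polynomial.hasseDeriv_coeff, Nat.add_sub_cancel' hn]
      refine mul_ne_zero ?_ (Polynomial.leadingCoeff_ne_zero.mpr hp)
      exact_mod_cast (Nat.choose_pos (Nat.sub_le _ _)).ne'
    set a := q.coeff n / r.coeff n
    have hdeg : (q - a • r).degree < n := by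
      rw [Polynomial.degree_lt_iff_coeff_zero]
      intro m hm
      rcases hm.eq_or_lt with rfl | hm
      · simp [a, hrcoeff]
      · rw [Polynomial.coeff_sub, Polynomial.coeff_smul,
          Polynomial.coeff_eq_zero_of_natDegree_lt (hrdeg.trans_lt hm),
          Polynomial.coeff_eq_zero_of_degree_lt (hq.trans_lt (by exact_mod_cast hm))]
        simp
    have hlow : ∑ i ∈ s, c i * (q - a • r).eval (y i) = 0 := by
      rcases eq_or_ne (q - a • r) 0 with h0 | h0
      · simp [h0]
      · have hlt := (Polynomial.natDegree_lt_iff_degree_lt h0).mpr hdeg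
        exact ih _ hlt _ (hlt.le.trans hn) Polynomial.degree_le_natDegree
    calc ∑ i ∈ s, c i * q.eval (y i)
        = ∑ i ∈ s, c i * (q - a • r).eval (y i) + a * ∑ i ∈ s, c i * r.eval (y i) := by
          rw [Finset.mul_sum, ← Finset.sum_add_distrib]
          refine Finset.sum_congr rfl fun i _ => ?_
          rw [Polynomial.eval_sub, Polynomial.eval_smul, smul_eq_mul]
          ring
      _ = 0 := by rw [hlow, hrsum, mul_zero, add_zero]

/-- At most `deg p + 1` distinct translates of a nonzero polynomial are linearly independent. -/
theorem eq_zero_of_sum_taylor_eq_zero {ι : Type*} [DecidableEq ι] (s : Finset ι) (c y : ι → ℂ)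
    {p : Polynomial ℂ} (hp : p ≠ 0) (hs : s.card ≤ p.natDegree + 1) (hy : Set.InjOn y s)
    (h : ∑ i ∈ s, c i • Polynomial.taylor (y i) p = 0) {i : ι} (hi : i ∈ s) : c i = 0 := by
  have hdeg : (Lagrange.basis s y i).degree ≤ p.natDegree := by
    rw [Lagrange.degree_basis hy hi]
    exact_mod_cast (by omega : s.card - 1 ≤ p.natDegree)
  have hsum := sum_mul_eval_eq_zero_of_sum_taylor_eq_zero s c y hp h _ _ le_rfl hdeg
  rw [Finset.sum_eq_single_of_mem i hi, Lagrange.eval_basis_self hy hi, mul_one] at hsum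
  · exact hsum
  · intro j hj hji
    rw [Lagrange.eval_basis_of_ne hji.symm hj, mul_zero]

theorem sum_choose_smul_taylor (p : Polynomial ℂ) (y : ℂ) :
    ∑ j ∈ Finset.range (p.natDegree + 1),
      ((-1) ^ (p.natDegree - j) * (p.natDegree.choose j : ℂ)) • Polynomial.taylor (y + j) p =
      (p.leadingCoeff * (p.natDegree.factorial : ℂ)) • (1 : Polynomial ℂ) := by
  refine Polynomial.funext fun x => ?_
  have h := congrFun p.fwdDiff_iter_degree_eq_factorial (x + y)
  rw [fwdDiff_iter_eq_sum_shift] at h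
  simpa [Polynomial.eval_finsetSum, Polynomial.taylor_eval, ← add_assoc, add_comm, add_left_comm]
    using h

theorem sum_choose_smul_taylor_add (p : Polynomial ℂ) (y : ℂ) :
    ∑ j ∈ Finset.range (p.natDegree + 1),
      ((-1) ^ j * (p.natDegree.choose j : ℂ)) • Polynomial.taylor (y + j) p =
      ((-1) ^ p.natDegree * (p.leadingCoeff * (p.natDegree.factorial : ℂ))) •
        (1 : Polynomial ℂ) := by
  rw [mul_smul, ← sum_choose_smul_taylor p y, Finset.smul_sum]
  refine Finset.sum_congr rfl fun j hj => ?_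
  rw [smul_smul, ← mul_assoc, ← pow_add]
  have hj' : p.natDegree + (p.natDegree - j) = j + 2 * (p.natDegree - j) := by
    have := Finset.mem_range.mp hj
    omega
  rw [hj', pow_add, pow_mul]
  simp

theorem sum_choose_smul_taylor_sub (p : Polynomial ℂ) (y : ℂ) :
    ∑ j ∈ Finset.range (p.natDegree + 1),
      ((-1) ^ j * (p.natDegree.choose j : ℂ)) • Polynomial.taylor (y - j) p =
      (p.leadingCoeff * (p.natDegree.factorial : ℂ)) • (1 : Polynomial ℂ) := by
  rw [← sum_choose_smul_taylor p (y - p.natDegree), ← Finset.sum_range_reflect]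
  refine Finset.sum_congr rfl fun j hj => ?_
  have hj' : j ≤ p.natDegree := Nat.lt_succ_iff.mp (Finset.mem_range.mp hj)
  rw [show p.natDegree + 1 - 1 - j = p.natDegree - j by omega, Nat.choose_symm hj',
    Nat.cast_sub hj']
  congr 3
  ring

theorem apply_opDp_taylor {p : Polynomial ℂ} {σ : ↥(Dp p) →ₗ[ℂ] ↥(Dp p)}
    (hσ : IsAntiInvolutionOn p σ) {ε : ℤ → ℂ}
    (hε : ∀ k, (σ (opDp p k 1) : Module.End ℂ LaurentV) = ε k • op k p) (k m : ℤ) :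
    (σ (opDp p (k + m) (Polynomial.taylor (m : ℂ) p)) : Module.End ℂ LaurentV) =
      op (k + m) (((ε k * ε m) • Polynomial.taylor (k : ℂ) p) * p) := by
  rw [hσ.2 (opDp p k 1) (opDp p m 1), hε, hε, smul_mul_smul_comm, op_mul_op, smul_mul_assoc,
    op_smul, add_comm m k, mul_comm (ε m)]
  simp only [coe_opDp, one_mul, op_mul_op]

theorem sign_mul_eq_neg_one_pow_mul {p : Polynomial ℂ} (hp : p ≠ 0)
    {σ : ↥(Dp p) →ₗ[ℂ] ↥(Dp p)} (hσ : IsAntiInvolutionOn p σ) {ε : ℤ → ℂ}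
    (hε : ∀ k, (σ (opDp p k 1) : Module.End ℂ LaurentV) = ε k • op k p) (k m : ℤ) :
    ε k * ε m = (-1) ^ p.natDegree * ε (k + m) := by
  set d := p.natDegree
  set L := p.leadingCoeff * (d.factorial : ℂ)
  have himage (j : ℕ) : (σ (opDp p (k + m) (Polynomial.taylor ((m : ℂ) + j) p)) :
      Module.End ℂ LaurentV) = op (k + m)
        (((ε (k - j) * ε (m + j)) • Polynomial.taylor ((k : ℂ) - j) p) * p) := by
    have h := apply_opDp_taylor hσ hε (k - j) (m + j)
    rw [show k - (j : ℤ) + (m + j) = k + m by ring] at h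
    exact_mod_cast h
  have hpoly : ∑ j ∈ Finset.range (d + 1), ((-1) ^ j * (d.choose j : ℂ)) •
      (ε (k - j) * ε (m + j)) • Polynomial.taylor ((k : ℂ) - j) p =
        ((-1) ^ d * L * ε (k + m)) • (1 : Polynomial ℂ) := by
    refine mul_right_cancel₀ hp (op_injective (k + m) ?_)
    have h := congrArg (fun f => (σ (opDp p (k + m) f) : Module.End ℂ LaurentV))
      (sum_choose_smul_taylor_add p m)
    simp only [map_sum, map_smul, Submodule.coe_sum, Submodule.coe_smul, himage, hε] at h
    rw [Finset.sum_mul, smul_mul_assoc, one_mul, mul_smul, op_smul, op_smul, ← h]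
    change opLinear (k + m) _ = _
    rw [map_sum]
    refine Finset.sum_congr rfl fun j _ => ?_
    rw [smul_mul_assoc, map_smul]
    rfl
  have hzero : ∑ j ∈ Finset.range (d + 1), ((-1) ^ j * (d.choose j : ℂ) *
      (ε (k - j) * ε (m + j) - (-1) ^ d * ε (k + m))) • Polynomial.taylor ((k : ℂ) - j) p = 0 := by
    simp only [mul_sub, sub_smul, Finset.sum_sub_distrib]
    rw [sub_eq_zero]
    simp only [mul_smul] at hpoly ⊢
    rw [hpoly]
    have h := congrArg (fun f => ((-1) ^ d * ε (k + m)) • f) (sum_choose_smul_taylor_sub p k)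
    simp only [Finset.smul_sum, smul_smul] at h ⊢
    rw [show (-1 : ℂ) ^ d * (L * ε (k + m)) = (-1) ^ d * ε (k + m) * L by ring, ← h]
    exact Finset.sum_congr rfl fun j _ => by
      congr 1
      ring
  have h := eq_zero_of_sum_taylor_eq_zero _ _ (fun j : ℕ => (k : ℂ) - j) hp
    (Finset.card_range _).le (fun a _ b _ hab => by simpa using hab) hzero
    (Finset.mem_range.mpr d.succ_pos)
  simpa [sub_eq_zero] using h

theorem epsilon_multiplicativity (p : Polynomial ℂ) (hp : p ≠ 0)
    (σ : ↥(Dp p) →ₗ[ℂ] ↥(Dp p)) (h1 : IsAntiInvolutionOn p σ) (h2 : PreservesGrading p σ)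
    (σ₀ : ↥(Dp 1) → ↥(Dp 1))
    (hσ₀ : ∀ (A : ↥(Dp 1)) (Y : ↥(Dp p)),
      (Y : Module.End ℂ LaurentV) = (A : Module.End ℂ LaurentV) * op 0 p →
      ((σ Y : Module.End ℂ LaurentV)) = (σ₀ A : Module.End ℂ LaurentV) * op 0 p)
    (ε : ℤ → ℂ) (hε : ∀ k : ℤ, ε k = 1 ∨ ε k = -1)
    (hεdef : ∀ (k : ℤ) (A : ↥(Dp 1)), (A : Module.End ℂ LaurentV) = op k 1 →
      ((σ₀ A : Module.End ℂ LaurentV)) = ε k • op k 1) :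
    (∀ k m : ℤ, ε (k + m) = ε 0 * ε k * ε m) ∧
    (∀ k : ℤ, ε k = ε 0 * (ε 0 * ε 1) ^ k) := by
  have hσ (k : ℤ) : (σ (opDp p k 1) : Module.End ℂ LaurentV) = ε k • op k p := by
    rw [hσ₀ (opDp 1 k 1) (opDp p k 1) (by simp [coe_opDp, op_mul_op]),
      hεdef k _ (by simp [coe_opDp]), smul_mul_assoc, op_mul_op]
    simp
  have hmul := sign_mul_eq_neg_one_pow_mul hp h1 hσ
  have hsq (k : ℤ) : ε k * ε k = 1 := by rcases hε k with h | h <;> simp [h]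
  have hzero : ε 0 = (-1) ^ p.natDegree := by
    have h := hmul 0 0
    rw [add_zero] at h
    exact mul_right_cancel₀ (left_ne_zero_of_mul_eq_one (hsq 0)) h
  have hadd (k m : ℤ) : ε (k + m) = ε 0 * ε k * ε m := by
    rw [mul_assoc, hmul, ← hzero, ← mul_assoc, hsq, one_mul]
  refine ⟨hadd, fun k => ?_⟩
  have hne : ε 0 * ε 1 ≠ 0 := mul_ne_zero (left_ne_zero_of_mul_eq_one (hsq 0))
    (left_ne_zero_of_mul_eq_one (hsq 1))
  induction k using Int.induction_on with
  | zero => simp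
  | succ k ih => rw [hadd, zpow_add_one₀ hne, ih]; ring
  | pred k ih =>
    refine mul_right_cancel₀ hne ?_
    rw [mul_assoc (ε 0), ← zpow_add_one₀ hne, sub_add_cancel, ← ih]
    have h := hadd (-(k : ℤ) - 1) 1
    rw [sub_add_cancel] at h
    rw [h]
    ring

end
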